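/- Every hereditarily meta-Lindelöf, locally compact, scattered Tychonoff space whose Cantor–Bendixson height is strictly less than the ordinal ω₁·ω₁ is σ-discrete. -/

import Mathlib

open Set Topology Ordinal Cardinal

noncomputable section
universe u

/-- A topological space is *scattered* if every nonempty subset has a point isolated
in the subspace topology, i.e. there is an open set meeting the subset in exactly
that point. -/
def IsScattered (X : Type*) [TopologicalSpace X] : Prop :=
  ∀ S : Set X, S.Nonempty → ∃ x ∈ S, ∃ U : Set X, IsOpen U ∧ U ∩ S = {x}

/-- A space is *meta-Lindelöf* if every open cover has a point-countable open refinement. -/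
def IsMetaLindelof (X : Type*) [TopologicalSpace X] : Prop :=
  ∀ 𝒰 : Set (Set X), (∀ U ∈ 𝒰, IsOpen U) → ⋃₀ 𝒰 = Set.univ →
    ∃ 𝒱 : Set (Set X), (∀ V ∈ 𝒱, IsOpen V) ∧ ⋃₀ 𝒱 = Set.univ ∧
      (∀ V ∈ 𝒱, ∃ U ∈ 𝒰, V ⊆ U) ∧ ∀ x : X, {V ∈ 𝒱 | x ∈ V}.Countable

/-- A space is *hereditarily meta-Lindelöf* if every subspace is meta-Lindelöf. -/
def HereditarilyMetaLindelof (X : Type*) [TopologicalSpace X] : Prop :=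
  ∀ S : Set X, IsMetaLindelof S

/-- A space is *σ-discrete* if it is a countable union of subspaces, each of which is
discrete in its subspace topology. -/
def IsSigmaDiscrete (X : Type*) [TopologicalSpace X] : Prop :=
  ∃ D : ℕ → Set X, (⋃ n, D n) = Set.univ ∧ ∀ n, DiscreteTopology (D n)

/-- The Cantor–Bendixson derivatives `cbDeriv X α = X^(α)`: for each `β < α` we intersect
the set of non-isolated points of `X^(β)`.  This agrees with the usual transfinite
iteration: `X^(0) = X`, `X^(α+1)` is the set of non-isolated points of `X^(α)`, and at
limit ordinals one takes intersections. -/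
def cbDeriv (X : Type*) [TopologicalSpace X] (o : Ordinal) : Set X :=
  ⋂ p : {b : Ordinal // b < o},
    (cbDeriv X p.1 ∩ {x | x ∈ closure (cbDeriv X p.1 \ {x})})
termination_by o
decreasing_by exact p.2

/-- The Cantor–Bendixson height of a space: the least ordinal `α` with `X^(α) = ∅`. -/
def cbHeight (X : Type*) [TopologicalSpace X] : Ordinal :=
  sInf {o : Ordinal | cbDeriv X o = ∅}

/-- A space `X` is *Eberlein–Grothendieck* if it embeds into `C_p(K)`, the space of
continuous real-valued functions on a compact Hausdorff space `K` with the topology of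
pointwise convergence (the subspace topology from the product topology on `K → ℝ`). -/
def EberleinGrothendieck (X : Type u) [TopologicalSpace X] : Prop :=
  ∃ (K : Type u) (_ : TopologicalSpace K), CompactSpace K ∧ T2Space K ∧
    ∃ f : X → {g : K → ℝ // Continuous g}, IsEmbedding f

/-- The weight of a topological space: the least cardinality of a base for the topology. -/
def tweight (X : Type u) [TopologicalSpace X] : Cardinal.{u} :=
  sInf {c : Cardinal.{u} | ∃ B : Set (Set X), TopologicalSpace.IsTopologicalBasis B ∧ #B = c}

/-- A space is *locally countable* if every point has a countable open neighborhood. -/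
def LocallyCountable (X : Type*) [TopologicalSpace X] : Prop :=
  ∀ x : X, ∃ U : Set X, IsOpen U ∧ x ∈ U ∧ U.Countable

/-- `SigmaDiscreteOn A` : some countable colouring of `A` has relatively discrete colour classes. -/
def SigmaDiscreteOn {X : Type u} [TopologicalSpace X] (A : Set X) : Prop :=
  ∃ c : X → ℕ, ∀ x ∈ A, ∃ U : Set X, IsOpen U ∧ x ∈ U ∧ ∀ y ∈ A, y ∈ U → c y = c x → y = x

/-- A point-countable expansion of the points of `O` to open sets. -/
def HasPointCountableExpansion {X : Type u} [TopologicalSpace X] (O : Set X) : Prop :=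
  ∃ W : X → Set X, (∀ x ∈ O, IsOpen (W x) ∧ x ∈ W x) ∧ ∀ y, {x ∈ O | y ∈ W x}.Countable

theorem hasPointCountableExpansion_sUnion {X : Type u} [TopologicalSpace X]
    (hml : HereditarilyMetaLindelof X) (G : Set (Set X))
    (hG : ∀ O ∈ G, IsOpen O ∧ HasPointCountableExpansion O) :
    HasPointCountableExpansion (⋃₀ G) := by
  have hO : IsOpen (⋃₀ G) := isOpen_sUnion fun O h => (hG O h).1
  obtain ⟨𝒱, hV, hcov, href, hcount⟩ := hml (⋃₀ G)
    {V | ∃ O ∈ G, V = ((↑) : (⋃₀ G : Set X) → X) ⁻¹' O}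
    (by rintro V ⟨O, h, rfl⟩; exact (hG O h).1.preimage continuous_subtype_val)
    (by
      refine eq_univ_of_forall fun x => ?_
      obtain ⟨O, h, hx⟩ := x.2
      exact ⟨_, ⟨O, h, rfl⟩, hx⟩)
  have href' : ∀ V : Set (⋃₀ G : Set X), ∃ O : Set X, V ∈ 𝒱 →
      O ∈ G ∧ V ⊆ ((↑) : (⋃₀ G : Set X) → X) ⁻¹' O := by
    intro V
    by_cases h : V ∈ 𝒱
    · obtain ⟨U, ⟨O, h1, rfl⟩, h2⟩ := href V h
      exact ⟨O, fun _ => ⟨h1, h2⟩⟩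
    · exact ⟨∅, fun h' => absurd h' h⟩
  choose O hOV using href'
  have hexp : ∀ V : Set (⋃₀ G : Set X), ∃ W : X → Set X, V ∈ 𝒱 →
      (∀ x ∈ O V, IsOpen (W x) ∧ x ∈ W x) ∧ ∀ y, {x ∈ O V | y ∈ W x}.Countable := by
    intro V
    by_cases h : V ∈ 𝒱
    · obtain ⟨W, hW⟩ := (hG _ (hOV V h).1).2
      exact ⟨W, fun _ => hW⟩
    · exact ⟨fun _ => ∅, fun h' => absurd h' h⟩
  choose W hW using hexp
  have hmem : ∀ x : X, ∃ V : Set (⋃₀ G : Set X), ∀ hx : x ∈ ⋃₀ G, V ∈ 𝒱 ∧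
      (⟨x, hx⟩ : (⋃₀ G : Set X)) ∈ V := by
    intro x
    by_cases hx : x ∈ ⋃₀ G
    · have : (⟨x, hx⟩ : (⋃₀ G : Set X)) ∈ ⋃₀ 𝒱 := hcov ▸ mem_univ _
      obtain ⟨V, h1, h2⟩ := this
      exact ⟨V, fun _ => ⟨h1, h2⟩⟩
    · exact ⟨∅, fun h => absurd h hx⟩
  choose V hVx using hmem
  refine ⟨fun x => ((↑) '' (V x)) ∩ W (V x) x, fun x hx => ?_, fun y => ?_⟩
  · obtain ⟨h1, h2⟩ := hVx x hx
    obtain ⟨h3, h4⟩ := (hW _ h1).1 x ((hOV _ h1).2 h2)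
    exact ⟨(hO.isOpenMap_subtype_val _ (hV _ h1)).inter h3, ⟨_, h2, rfl⟩, h4⟩
  · by_cases hy : y ∈ ⋃₀ G
    · refine ((hcount ⟨y, hy⟩).biUnion (t := fun V _ => {x ∈ O V | y ∈ W V x})
        fun V hV' => (hW V hV'.1).2 y).mono ?_
      rintro x ⟨hx, ⟨y', hy', rfl⟩, h2⟩
      obtain ⟨h3, h4⟩ := hVx x hx
      exact mem_biUnion (x := V x) ⟨h3, hy'⟩ ⟨(hOV _ h3).2 h4, h2⟩
    · convert countable_empty
      refine eq_empty_of_forall_notMem ?_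
      rintro x ⟨hx, ⟨y', hy', rfl⟩, h2⟩
      exact hy y'.2

theorem hasPointCountableExpansion_univ {X : Type u} [TopologicalSpace X]
    (hml : HereditarilyMetaLindelof X) (hsc : IsScattered X) :
    HasPointCountableExpansion (univ : Set X) := by
  set G : Set (Set X) := {O | IsOpen O ∧ HasPointCountableExpansion O} with hGdef
  have hGexp := hasPointCountableExpansion_sUnion hml G fun O h => h
  have hGopen : IsOpen (⋃₀ G) := isOpen_sUnion fun O h => h.1
  suffices h : ⋃₀ G = Set.univ from h ▸ hGexp
  by_contra hne
  obtain ⟨x, hx, U, hU, hUx⟩ := hsc (⋃₀ G)ᶜ (nonempty_compl.mpr hne)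
  obtain ⟨W, hW, hWc⟩ := hGexp
  classical
  have hxU : x ∈ U := (hUx.symm ▸ mem_singleton x : x ∈ U ∩ (⋃₀ G)ᶜ).1
  have hsub : ∀ z ∈ ⋃₀ G ∪ U, z ≠ x → z ∈ ⋃₀ G := by
    intro z hz hzx
    by_contra hzG
    have hzmem : z ∈ U ∩ (⋃₀ G)ᶜ := ⟨hz.resolve_left hzG, hzG⟩
    rw [hUx] at hzmem
    exact hzx hzmem
  refine hx ⟨⋃₀ G ∪ U, ⟨hGopen.union hU, Function.update W x U, fun z hz => ?_, fun y => ?_⟩,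
    Or.inr hxU⟩
  · by_cases hzx : z = x
    · subst hzx; simpa using ⟨hU, hxU⟩
    · simpa [Function.update_of_ne hzx] using hW z (hsub z hz hzx)
  · refine ((hWc y).insert x).mono ?_
    rintro z ⟨hz, hyz⟩
    by_cases hzx : z = x
    · exact Or.inl hzx
    · rw [Function.update_of_ne hzx] at hyz
      exact Or.inr ⟨hsub z hz hzx, hyz⟩

theorem mem_cbDeriv_iff {X : Type u} [TopologicalSpace X] (o : Ordinal.{u}) (x : X) :
    x ∈ cbDeriv X o ↔ ∀ b < o, x ∈ cbDeriv X b ∧ x ∈ closure (cbDeriv X b \ {x}) := by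
  rw [cbDeriv]
  simp

theorem IsScattered.exists_cbDeriv_eq_empty {X : Type u} [TopologicalSpace X]
    (hsc : IsScattered X) : ∃ o : Ordinal.{u}, cbDeriv X o = ∅ := by
  by_contra! h
  choose f hf U hU hUf using fun o => hsc (cbDeriv X o) (h o)
  have key : ∀ a b : Ordinal.{u}, a < b → f a ≠ f b := by
    intro a b hab he
    have h1 := ((mem_cbDeriv_iff b (f b)).1 (hf b) a hab).2
    rw [← he, mem_closure_iff] at h1
    obtain ⟨z, hz, hz1, hz2⟩ := h1 (U a) (hU a)
      (hUf a ▸ mem_singleton (f a) : f a ∈ U a ∩ cbDeriv X a).1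
    have : z ∈ U a ∩ cbDeriv X a := ⟨hz, hz1⟩
    rw [hUf a] at this
    exact hz2 this
  refine not_injective_of_ordinal f fun a b hab => ?_
  rcases lt_trichotomy a b with h | h | h
  · exact absurd hab (key a b h)
  · exact h
  · exact absurd hab.symm (key b a h)

theorem IsScattered.exists_rank {X : Type u} [TopologicalSpace X] (hsc : IsScattered X) :
    ∃ ρ : X → Ordinal.{u}, ∀ x, ∃ U : Set X, IsOpen U ∧ x ∈ U ∧ ∀ y ∈ U, y ≠ x → ρ y < ρ x := by
  obtain ⟨o, ho⟩ := hsc.exists_cbDeriv_eq_empty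
  refine ⟨fun x => sInf {a | x ∉ cbDeriv X a}, fun x => ?_⟩
  have hx : x ∉ cbDeriv X (sInf {a | x ∉ cbDeriv X a}) :=
    csInf_mem (s := {a | x ∉ cbDeriv X a}) ⟨o, by simp [ho]⟩
  have hmin : ∀ b < sInf {a | x ∉ cbDeriv X a}, x ∈ cbDeriv X b := by
    intro b hb
    by_contra hxb
    exact absurd (csInf_le' (s := {a | x ∉ cbDeriv X a}) hxb) (not_le.mpr hb)
  rw [mem_cbDeriv_iff] at hx
  push Not at hx
  obtain ⟨b, hb, hx⟩ := hx
  refine ⟨(closure (cbDeriv X b \ {x}))ᶜ, isClosed_closure.isOpen_compl, hx (hmin b hb), ?_⟩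
  intro y hy hyx
  refine lt_of_le_of_lt (csInf_le' (s := {a | y ∉ cbDeriv X a}) ?_) hb
  exact fun hyb => hy (subset_closure ⟨hyb, hyx⟩)

theorem IsScattered.totallyDisconnectedSpace {X : Type u} [TopologicalSpace X] [T1Space X]
    (hsc : IsScattered X) : TotallyDisconnectedSpace X := by
  refine ⟨fun t _ ht => ?_⟩
  by_contra hns
  rw [not_subsingleton_iff] at hns
  obtain ⟨x, hx, U, hU, hUx⟩ := hsc t hns.nonempty
  obtain ⟨y, hy, hyx⟩ := hns.exists_ne x
  have hxU : x ∈ U ∩ t := hUx ▸ mem_singleton x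
  obtain ⟨z, hz, hzU, hzx⟩ := ht U {x}ᶜ hU isOpen_compl_singleton
    (fun z _ => by
      by_cases hzx : z = x
      · exact Or.inl (hzx ▸ hxU.1)
      · exact Or.inr hzx) ⟨x, hx, hxU.1⟩ ⟨y, hy, hyx⟩
  have : z ∈ U ∩ t := ⟨hzU, hz⟩
  rw [hUx] at this
  exact hzx this

/-- Compact open neighbourhoods `W x` of the points, point-countable, and shrinking in rank. -/
structure IsRankedExpansion {X : Type u} [TopologicalSpace X] (W : X → Set X)
    (ρ : X → Ordinal.{u}) : Prop where
  isOpen : ∀ x, IsOpen (W x)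
  isCompact : ∀ x, IsCompact (W x)
  mem_self : ∀ x, x ∈ W x
  countable : ∀ y, {x | y ∈ W x}.Countable
  rank_lt : ∀ x, ∀ y ∈ W x, y ≠ x → ρ y < ρ x

theorem exists_isRankedExpansion {X : Type u} [TopologicalSpace X] [T2Space X]
    [LocallyCompactSpace X] (hml : HereditarilyMetaLindelof X) (hsc : IsScattered X) :
    ∃ (W : X → Set X) (ρ : X → Ordinal.{u}), IsRankedExpansion W ρ := by
  have := hsc.totallyDisconnectedSpace
  obtain ⟨ρ, hρ⟩ := hsc.exists_rank
  choose U hU hxU hUρ using hρ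
  obtain ⟨W, hW, hWc⟩ := hasPointCountableExpansion_univ hml hsc
  have hex : ∀ x, ∃ C : Set X, IsOpen C ∧ IsCompact C ∧ x ∈ C ∧ C ⊆ W x ∩ U x := by
    intro x
    have hmem : W x ∩ U x ∈ 𝓝 x :=
      (((hW x trivial).1.inter (hU x)).mem_nhds ⟨(hW x trivial).2, hxU x⟩)
    obtain ⟨K, hK, hKs, hKc⟩ := local_compact_nhds hmem
    obtain ⟨C, hC, hxC, hCK⟩ := loc_compact_Haus_tot_disc_of_zero_dim.mem_nhds_iff.1 hK
    exact ⟨C, hC.isOpen, hKc.of_isClosed_subset hC.isClosed hCK, hxC, hCK.trans hKs⟩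
  choose C hCo hCc hxC hCs using hex
  refine ⟨C, ρ, hCo, hCc, hxC, fun y => (hWc y).mono ?_, fun x y hy => hUρ x y (hCs x hy).2⟩
  exact fun x hx => ⟨trivial, (hCs x hx).1⟩

/-- `M` is upward closed and every trace `{x ∈ M | y ∈ W x}` is either empty or the full trace
of a point of `M`. -/
def ReflectsTraces {X : Type u} (W : X → Set X) (M : Set X) : Prop :=
  (∀ y ∈ M, ∀ x, y ∈ W x → x ∈ M) ∧
    ∀ y, (∃ x ∈ M, y ∈ W x) → ∃ z ∈ M, ∀ x, z ∈ W x ↔ x ∈ M ∧ y ∈ W x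

theorem SigmaDiscreteOn.of_chain {X : Type u} [TopologicalSpace X] {W : X → Set X}
    {ρ : X → Ordinal.{u}} (hW : IsRankedExpansion W ρ) {ι : Type*} [LinearOrder ι]
    [WellFoundedLT ι] (M : ι → Set X) (hmono : Monotone M)
    (hM : ∀ i, ReflectsTraces W (M i)) (hsd : ∀ i, SigmaDiscreteOn (M i)) :
    SigmaDiscreteOn (⋃ i, M i) := by
  classical
  rcases isEmpty_or_nonempty ι with hι | hι
  · exact ⟨fun _ => 0, by simp⟩
  have hl : ∀ y, ∃ i, y ∈ ⋃ i, M i → y ∈ M i ∧ ∀ j, y ∈ M j → i ≤ j := by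
    intro y
    by_cases hy : y ∈ ⋃ i, M i
    · have hne : {i | y ∈ M i}.Nonempty := mem_iUnion.1 hy
      have hwf : WellFounded ((· < ·) : ι → ι → Prop) := wellFounded_lt
      exact ⟨hwf.min _ hne, fun _ => ⟨hwf.min_mem _ hne,
        fun j hj => hwf.min_le hj⟩⟩
    · exact ⟨Classical.arbitrary ι, fun h => absurd h hy⟩
  choose l hl using hl
  have hup : ∀ y ∈ ⋃ i, M i, ∀ x, y ∈ W x → x ∈ ⋃ i, M i ∧ l x ≤ l y := by
    intro y hy x hyx
    have hx : x ∈ M (l y) := (hM (l y)).1 y (hl y hy).1 x hyx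
    have hx' := mem_iUnion_of_mem _ hx
    exact ⟨hx', (hl x hx').2 _ hx⟩
  set Z : X → Set ι := fun y => l '' {x | y ∈ W x} with hZ
  have hfin : ∀ y ∈ ⋃ i, M i, (Z y).Finite := by
    intro y hy
    have hex : ∀ i : Z y, ∃ z ∈ M i, l z = i ∧ ∀ x, z ∈ W x ↔ x ∈ M i ∧ y ∈ W x := by
      rintro ⟨_, x, hx, rfl⟩
      have hxU := (hup y hy x hx).1
      obtain ⟨z, hz, hzx⟩ := (hM (l x)).2 y ⟨x, (hl x hxU).1, hx⟩
      have hzU := mem_iUnion_of_mem _ hz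
      exact ⟨z, hz, le_antisymm ((hl z hzU).2 _ hz)
        (hup z hzU x ((hzx x).2 ⟨(hl x hxU).1, hx⟩)).2, hzx⟩
    choose z hz hlz hzx using hex
    have hanti : StrictAnti fun i : Z y => ρ (z i) := by
      intro i j hij
      refine hW.rank_lt _ _ ((hzx j _).2 ⟨hmono hij.le (hz i), ?_⟩) ?_
      · exact ((hzx i _).1 (hW.mem_self _)).2
      · intro he
        have : (j : ι) = i := by rw [← hlz i, ← hlz j, he]
        exact hij.ne' (Subtype.ext this)
    have : WellFoundedGT (Z y) := hanti.wellFoundedGT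
    have : Finite (Z y) := Finite.of_wellFoundedLT_wellFoundedGT _
    exact Set.toFinite _
  choose c hc using hsd
  refine ⟨fun y => Nat.pair (Z y).ncard (c (l y) y), fun x hx => ?_⟩
  obtain ⟨U, hU, hxU, hUc⟩ := hc (l x) x (hl x hx).1
  have hrep : ∀ i, ∃ a, i ∈ Z x → x ∈ W a ∧ l a = i := by
    intro i
    by_cases hi : i ∈ Z x
    · obtain ⟨a, ha, hai⟩ := hi
      exact ⟨a, fun _ => ⟨ha, hai⟩⟩
    · exact ⟨x, fun h => absurd h hi⟩
  choose a ha using hrep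
  refine ⟨U ∩ ⋂ i ∈ Z x, W (a i), hU.inter ((hfin x hx).isOpen_biInter fun i _ => hW.isOpen _),
    ⟨hxU, mem_iInter₂.2 fun i hi => (ha i hi).1⟩, ?_⟩
  rintro y hy ⟨hyU, hyW⟩ hcy
  obtain ⟨h1, h2⟩ := Nat.pair_eq_pair.1 hcy
  have hsub : Z x ⊆ Z y := fun i hi => ⟨a i, mem_iInter₂.1 hyW i hi, (ha i hi).2⟩
  have heq : Z x = Z y := eq_of_subset_of_ncard_le hsub h1.le (hfin y hy)
  have hle : ∀ u ∈ ⋃ i, M i, ∀ v, Z u = Z v → l v ≤ l u := by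
    intro u hu v huv
    have : l v ∈ Z u := huv ▸ ⟨v, hW.mem_self v, rfl⟩
    obtain ⟨b, hb, hbv⟩ := this
    exact hbv ▸ (hup u hu b hb).2
  have hlxy : l y = l x := le_antisymm (hle x hx y heq) (hle y hy x heq.symm)
  rw [hlxy] at h2
  exact hUc y (hlxy ▸ (hl y hy).1) hyU h2

/-- Closing off under countably-valued finitary operations. -/
theorem exists_monotone_closure {X : Type u} (G : Finset X → Set X)
    (hG : ∀ F, (G F).Countable) :
    ∃ M : Set X → Set X, Monotone M ∧ ∀ S, S ⊆ M S ∧ #(M S) ≤ max #S ℵ₀ ∧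
      ∀ F : Finset X, ↑F ⊆ M S → G F ⊆ M S := by
  set step : Set X → Set X := fun A => A ∪ ⋃ F : {F : Finset X // ↑F ⊆ A}, G F with hstep
  have hle : ∀ A, A ⊆ step A := fun A => subset_union_left
  have hmono : Monotone step := by
    intro A B hAB x hx
    rcases hx with hx | hx
    · exact Or.inl (hAB hx)
    · obtain ⟨F, hF⟩ := mem_iUnion.1 hx
      exact Or.inr (mem_iUnion.2 ⟨⟨F.1, F.2.trans hAB⟩, hF⟩)
  have hfinset : ∀ (A : Set X) (c : Cardinal.{u}), ℵ₀ ≤ c → #A ≤ c →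
      #{F : Finset X // ↑F ⊆ A} ≤ c := by
    intro A c hc hA
    classical
    have h1 : #{F : Finset X // ↑F ⊆ A} ≤ #(Finset A) := by
      refine mk_le_of_injective (f := fun F => F.1.subtype (· ∈ A)) fun F F' h => ?_
      apply Subtype.ext
      have h2 := congrArg (Finset.map (Function.Embedding.subtype (· ∈ A))) h
      simp only [Finset.subtype_map] at h2
      rwa [Finset.filter_true_of_mem fun x hx => F.2 hx,
        Finset.filter_true_of_mem fun x hx => F'.2 hx] at h2
    refine h1.trans ?_
    rcases finite_or_infinite A with h | h
    · exact (lt_aleph0_of_finite _).le.trans hc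
    · rwa [mk_finset_of_infinite]
  have hcard : ∀ (c : Cardinal.{u}), ℵ₀ ≤ c → ∀ A : Set X, #A ≤ c → #(step A) ≤ c := by
    intro c hc A hA
    refine (mk_union_le _ _).trans (add_le_of_le hc hA ((mk_iUnion_le _).trans ?_))
    refine mul_le_of_le hc (hfinset A c hc hA) ?_
    exact (ciSup_le' fun F : {F : Finset X // ↑F ⊆ A} => le_aleph0_iff_set_countable.2 (hG F.1)).trans hc
  have hchain : ∀ S, Monotone fun n : ℕ => step^[n] S := by
    intro S
    refine monotone_nat_of_le_succ fun n => ?_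
    rw [Function.iterate_succ_apply']
    exact hle _
  refine ⟨fun S => ⋃ n : ℕ, step^[n] S, ?_, fun S => ⟨?_, ?_, ?_⟩⟩
  · intro A B hAB
    exact iUnion_mono fun n => hmono.iterate n hAB
  · exact subset_iUnion (fun n : ℕ => step^[n] S) 0
  · have hn : ∀ n : ℕ, #(step^[n] S : Set X) ≤ max #S ℵ₀ := by
      intro n
      induction n with
      | zero => exact le_max_left _ _
      | succ n ih =>
        rw [Function.iterate_succ_apply']
        exact hcard _ (le_max_right _ _) _ ih
    have h := mk_iUnion_le_lift (fun n : ℕ => step^[n] S)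
    simp only [Cardinal.lift_uzero, mk_nat, lift_aleph0] at h
    refine h.trans (mul_le_of_le (le_max_right _ _) (le_max_right _ _) ?_)
    exact ciSup_le' fun n => by simpa using hn n
  · intro F hF
    obtain ⟨n, hn⟩ : ∃ n, (F : Set X) ⊆ step^[n] S :=
      (hchain S).directed_le.exists_mem_subset_of_finset_subset_biUnion hF
    refine subset_trans ?_ (subset_iUnion (fun n : ℕ => step^[n] S) (n + 1))
    rw [Function.iterate_succ_apply']
    exact fun x hx => Or.inr (mem_iUnion.2 ⟨⟨F, hn⟩, hx⟩)

theorem exists_reflectsTraces_closure {X : Type u} [TopologicalSpace X] [T2Space X]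
    {W : X → Set X} {ρ : X → Ordinal.{u}} (hW : IsRankedExpansion W ρ) :
    ∃ M : Set X → Set X, Monotone M ∧ ∀ S, S ⊆ M S ∧ #(M S) ≤ max #S ℵ₀ ∧
      ReflectsTraces W (M S) := by
  classical
  have hwit : ∀ F P : Finset X, ∃ G : Set X, G.Countable ∧
      ∀ y, (∀ x ∈ F, y ∈ W x ↔ x ∈ P) → ∃ z ∈ G, ∀ x ∈ F, z ∈ W x ↔ x ∈ P := by
    intro F P
    by_cases h : ∃ y, ∀ x ∈ F, y ∈ W x ↔ x ∈ P
    · obtain ⟨z, hz⟩ := h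
      exact ⟨{z}, countable_singleton z, fun _ _ => ⟨z, rfl, hz⟩⟩
    · exact ⟨∅, countable_empty, fun y hy => absurd ⟨y, hy⟩ h⟩
  choose w hwc hw using hwit
  obtain ⟨M, hmono, hM⟩ := exists_monotone_closure
    (fun F : Finset X => (⋃ y ∈ F, {x | y ∈ W x}) ∪ ⋃ P ∈ F.powerset, w F P)
    (fun F => ((F.countable_toSet.biUnion fun y _ => hW.countable y)).union
      (F.powerset.countable_toSet.biUnion fun P _ => hwc F P))
  refine ⟨M, hmono, fun S => ⟨(hM S).1, (hM S).2.1, ?_⟩⟩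
  have hcl := (hM S).2.2
  have hup : ∀ y ∈ M S, ∀ x, y ∈ W x → x ∈ M S := fun y hy x hx =>
    hcl {y} (by simpa using hy) (Or.inl (by simpa using hx))
  refine ⟨hup, fun y => ?_⟩
  rintro ⟨x₀, hx₀, hyx₀⟩
  by_contra! hno
  have hclosed : IsClosed (M S) := by
    rw [← isOpen_compl_iff, isOpen_iff_forall_mem_open]
    exact fun x hx => ⟨W x, fun z hz hzM => hx (hup z hzM x hz), hW.isOpen x, hW.mem_self x⟩
  have hsep : ∀ z ∈ M S, ∃ x ∈ M S, ¬(z ∈ W x ↔ y ∈ W x) := by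
    intro z hz
    by_contra! h
    obtain ⟨x, hx⟩ := hno z hz
    have := hup z hz x
    have := h x
    tauto
  obtain ⟨b, hbM, hbfin, hb⟩ := ((hW.isCompact x₀).inter_right hclosed).elim_finite_subcover_image
    (b := M S) (c := fun x => {z | ¬(z ∈ W x ↔ y ∈ W x)})
    (fun x _ => by
      by_cases hyx : y ∈ W x
      · simpa [hyx, compl_def] using (hW.isCompact x).isClosed.isOpen_compl
      · simpa [hyx] using hW.isOpen x)
    (fun z hz => by
      obtain ⟨x, hx, hzx⟩ := hsep z hz.2
      exact mem_biUnion hx hzx)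
  set F : Finset X := insert x₀ hbfin.toFinset with hF
  obtain ⟨z, hz, hzF⟩ := hw F (F.filter fun x => y ∈ W x) y (by simp +contextual)
  have hFM : (F : Set X) ⊆ M S := by
    simp only [hF, Finset.coe_insert, Finite.coe_toFinset]
    exact insert_subset hx₀ hbM
  have hzM : z ∈ M S := hcl F hFM
    (Or.inr (mem_biUnion (Finset.mem_powerset.2 (Finset.filter_subset _ _)) hz))
  have hzx₀ : z ∈ W x₀ := (hzF x₀ (by simp [hF])).2 (by simp [hF, hyx₀])
  obtain ⟨x, hx, hzx⟩ := mem_iUnion₂.1 (hb ⟨hzx₀, hzM⟩)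
  have hxF : x ∈ F := by simp [hF, hx]
  exact hzx ((hzF x hxF).trans (by simp [hxF]))

theorem SigmaDiscreteOn.mono {X : Type u} [TopologicalSpace X] {A B : Set X}
    (hB : SigmaDiscreteOn B) (h : A ⊆ B) : SigmaDiscreteOn A := by
  obtain ⟨c, hc⟩ := hB
  refine ⟨c, fun x hx => ?_⟩
  obtain ⟨U, hU, hxU, hUc⟩ := hc x (h hx)
  exact ⟨U, hU, hxU, fun y hy => hUc y (h hy)⟩

theorem IsRankedExpansion.sigmaDiscreteOn {X : Type u} [TopologicalSpace X] [T2Space X]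
    {W : X → Set X} {ρ : X → Ordinal.{u}} (hW : IsRankedExpansion W ρ) (A : Set X) :
    SigmaDiscreteOn A := by
  obtain ⟨M, hmono, hM⟩ := exists_reflectsTraces_closure hW
  induction hκ : #A using Cardinal.lt_wf.induction generalizing A with
  | _ κ ih =>
    rcases le_or_gt κ ℵ₀ with hle | hlt
    · obtain ⟨c, hc⟩ := countable_iff_exists_injOn.1
        (le_aleph0_iff_set_countable.1 (hκ.le.trans hle))
      exact ⟨c, fun x hx => ⟨univ, isOpen_univ, trivial, fun y hy _ h => hc hy hx h⟩⟩
    · obtain ⟨e⟩ : Nonempty (κ.ord.ToType ≃ A) := by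
        rw [← Cardinal.eq, mk_ord_toType, hκ]
      set N : κ.ord.ToType → Set X := fun i => M ((fun j => (e j : X)) '' Iic i) with hN
      have hcard : ∀ i, #(N i) < κ := by
        intro i
        refine (hM _).2.1.trans_lt (max_lt (mk_image_le.trans_lt ?_) hlt)
        rw [← Iio_insert]
        refine (mk_insert_le).trans_lt (add_lt_of_lt hlt.le (by simpa using mk_Iio_lt i) ?_)
        exact one_lt_aleph0.trans hlt
      refine (SigmaDiscreteOn.of_chain hW N (fun i j hij => hmono (image_mono (Iic_subset_Iic.2 hij)))
        (fun i => (hM _).2.2) fun i => ih _ (hcard i) _ rfl).mono fun x hx => ?_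
      refine mem_iUnion.2 ⟨e.symm ⟨x, hx⟩, (hM _).1 ⟨e.symm ⟨x, hx⟩, mem_Iic.2 le_rfl, by simp⟩⟩

/-- Every hereditarily meta-Lindelöf, locally compact, scattered Tychonoff space whose
Cantor–Bendixson height is strictly less than `ω₁ · ω₁` is σ-discrete. -/
theorem sigmaDiscrete_of_heredMetaLindelof_locallyCompact_scattered_height_lt
    (X : Type u) [TopologicalSpace X] [T35Space X] [LocallyCompactSpace X]
    (hml : HereditarilyMetaLindelof X) (hsc : IsScattered X)
    (hht : cbHeight X < ω₁ * ω₁) :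
    IsSigmaDiscrete X := by
  obtain ⟨W, ρ, hW⟩ := exists_isRankedExpansion hml hsc
  obtain ⟨c, hc⟩ := hW.sigmaDiscreteOn univ
  refine ⟨fun n => c ⁻¹' {n}, ?_, fun n => discreteTopology_subtype_iff'.2 fun x hx => ?_⟩
  · rw [← preimage_iUnion, iUnion_of_singleton, preimage_univ]
  · obtain ⟨U, hU, hxU, hUc⟩ := hc x trivial
    refine ⟨U, hU, Subset.antisymm ?_ (singleton_subset_iff.2 ⟨hxU, hx⟩)⟩
    rintro y ⟨hyU, hy⟩
    exact hUc y trivial hyU (Eq.trans hy (Eq.symm hx))
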